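/- Let Λ ∈ M_{n,n}(ℂ). Let P : ℂⁿ → ℂⁿ be homogeneous of degree μ ≥ 2 with associated symmetric multilinear map P̃ and satisfying P(Λz) = Λ·P(z) for all z, and let H : ℂⁿ → ℂⁿ be homogeneous of degree d ≥ 2 with associated symmetric multilinear map H̃ and satisfying H(Λz) = Λ·H(z) for all z. Define L_{P,Λ}(H) : ℂⁿ → ℂⁿ by L_{P,Λ}(H)(z) = d·H̃(P(z), Λz, …, Λz) − μ·P̃(H(z), z, …, z). Then L_{P,Λ}(H)(Λz) = Λ·L_{P,Λ}(H)(z) for all z ∈ ℂⁿ; that is, L_{P,Λ} maps Λ-resonant homogeneous maps of degree d to Λ-resonant homogeneous maps of degree d+μ−1. -/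

import Mathlib

namespace MultilinearMap

variable {ι E F : Type*} [Fintype ι] [DecidableEq ι] [AddCommGroup E] [Module ℂ E]
  [NormedAddCommGroup F] [NormedSpace ℂ F]

/-- The diagonal of a multilinear map is differentiable along lines, with derivative given by
`MultilinearMap.linearDeriv`. -/
theorem hasDerivAt_diagonal_line (T : MultilinearMap ℂ (fun _ : ι => E) F) (x a : E) :
    HasDerivAt (fun t : ℂ => T fun _ => x + t • a)
      (T.linearDeriv (fun _ => x) fun _ => a) 0 := by
  have key : (fun t : ℂ => T fun _ => x + t • a) = fun t : ℂ =>
      (T (fun _ => x) + t • T.linearDeriv (fun _ => x) fun _ => a) +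
        ∑ s : Finset ι with 2 ≤ s.card,
          t ^ s.card • T (s.piecewise (fun _ => a) fun _ => x) := by
    funext t
    have h := T.map_add_eq_map_add_linearDeriv_add (fun _ => x) (t • fun _ => a)
    rw [map_smul] at h
    refine h.trans ?_
    congr 1
    refine Finset.sum_congr rfl fun s _ => ?_
    have h2 := T.map_piecewise_smul (fun _ => t) (s.piecewise (fun _ => a) fun _ => x) s
    rw [Finset.prod_const] at h2
    rw [← h2]
    congr 1
    funext i
    by_cases hi : i ∈ s <;> simp [hi]
  rw [key]
  have h1 : HasDerivAt (fun t : ℂ => T (fun _ => x) + t • T.linearDeriv (fun _ => x) fun _ => a)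
      (T.linearDeriv (fun _ => x) fun _ => a) 0 := by
    simpa using ((hasDerivAt_id (0 : ℂ)).smul_const
      (T.linearDeriv (fun _ => x) fun _ => a)).const_add (T fun _ => x)
  have h2 : HasDerivAt (fun t : ℂ => ∑ s : Finset ι with 2 ≤ s.card,
      t ^ s.card • T (s.piecewise (fun _ => a) fun _ => x)) 0 0 := by
    have := HasDerivAt.fun_sum (u := Finset.univ.filter fun s : Finset ι => 2 ≤ s.card)
      fun s _ => (hasDerivAt_pow s.card (0 : ℂ)).smul_const
        (T (s.piecewise (fun _ => a) fun _ => x))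
    convert this using 1
    refine (Finset.sum_eq_zero fun s hs => ?_).symm
    have hs : 2 ≤ s.card := (Finset.mem_filter.mp hs).2
    rw [zero_pow (by omega), mul_zero, zero_smul]
  simpa using h1.fun_add h2

/-- If the diagonal of `T` commutes with a linear map, so does its derivative. -/
theorem linearDeriv_diagonal_of_commute [FiniteDimensional ℂ F]
    (T : MultilinearMap ℂ (fun _ : ι => F) F) (A : F →ₗ[ℂ] F)
    (hT : ∀ x, T (fun _ => A x) = A (T fun _ => x)) (x a : F) :
    T.linearDeriv (fun _ => A x) (fun _ => A a) = A (T.linearDeriv (fun _ => x) fun _ => a) := by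
  have h1 := T.hasDerivAt_diagonal_line (A x) (A a)
  have h2 := (LinearMap.toContinuousLinearMap A).hasFDerivAt.comp_hasDerivAt (0 : ℂ)
    (T.hasDerivAt_diagonal_line x a)
  refine h1.unique (h2.congr_of_eventuallyEq (.of_forall fun t => ?_))
  simp [← hT]

/-- For a symmetric map, the derivative of the diagonal is obtained by filling one slot. -/
theorem linearDeriv_diagonal_of_symm (T : MultilinearMap ℂ (fun _ : ι => E) F)
    (hT : ∀ (σ : Equiv.Perm ι) (v : ι → E), T (v ∘ σ) = T v) (j : ι) (x a : E) :
    T.linearDeriv (fun _ => x) (fun _ => a) =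
      (Fintype.card ι : ℂ) • T (fun i => if i = j then a else x) := by
  have h (i : ι) : T (Function.update (fun _ => x) i a) = T fun i => if i = j then a else x := by
    rw [← hT (Equiv.swap i j)]
    congr 1
    funext k
    simp only [Function.comp_apply, Function.update_apply, Equiv.swap_apply_eq_iff,
      Equiv.swap_apply_left]
  simp [linearDeriv_apply, h, Nat.cast_smul_eq_nsmul]

/-- A symmetric multilinear map whose diagonal commutes with `A` commutes with `A` on tuples
`(a, x, …, x)`. -/
theorem apply_ite_of_commute [FiniteDimensional ℂ F]
    (T : MultilinearMap ℂ (fun _ : ι => F) F) (A : F →ₗ[ℂ] F)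
    (hsymm : ∀ (σ : Equiv.Perm ι) (v : ι → F), T (v ∘ σ) = T v)
    (hT : ∀ x, T (fun _ => A x) = A (T fun _ => x)) (j : ι) (x a : F) :
    T (fun i => if i = j then A a else A x) = A (T fun i => if i = j then a else x) := by
  have h := T.linearDeriv_diagonal_of_commute A hT x a
  rw [T.linearDeriv_diagonal_of_symm hsymm j, T.linearDeriv_diagonal_of_symm hsymm j,
    map_smul] at h
  have : Nonempty ι := ⟨j⟩
  exact smul_right_injective F (Nat.cast_ne_zero.mpr Fintype.card_ne_zero) h

end MultilinearMap


/-- Lemma 1.5 of Abate–Raissy: `L_{P,Λ}` maps `Λ`-resonant homogeneous maps of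
degree `d` to `Λ`-resonant homogeneous maps of degree `d + μ − 1`: here
`L_{P,Λ}(H)(z) = d·H̃(P(z),Λz,…,Λz) − μ·P̃(H(z),z,…,z)`, and `L_{P,Λ}(H)(Λz) =
Λ·L_{P,Λ}(H)(z)` for all `z` whenever `P` and `H` are `Λ`-resonant. -/
theorem statement17 {n μ d : ℕ} (hμ : 2 ≤ μ) (hd : 2 ≤ d)
    (Λ : Matrix (Fin n) (Fin n) ℂ)
    (Pt : MultilinearMap ℂ (fun _ : Fin μ => Fin n → ℂ) (Fin n → ℂ))
    (Ht : MultilinearMap ℂ (fun _ : Fin d => Fin n → ℂ) (Fin n → ℂ))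
    (hPsymm : ∀ (σ : Equiv.Perm (Fin μ)) (v : Fin μ → Fin n → ℂ), Pt (v ∘ σ) = Pt v)
    (hHsymm : ∀ (σ : Equiv.Perm (Fin d)) (v : Fin d → Fin n → ℂ), Ht (v ∘ σ) = Ht v)
    (hPres : ∀ x : Fin n → ℂ, Pt (fun _ => Λ.mulVec x) = Λ.mulVec (Pt fun _ => x))
    (hHres : ∀ x : Fin n → ℂ, Ht (fun _ => Λ.mulVec x) = Λ.mulVec (Ht fun _ => x))
    (L : (Fin n → ℂ) → Fin n → ℂ)
    (hL : ∀ x : Fin n → ℂ, L x =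
      (d : ℂ) • Ht (fun i => if (i : ℕ) = 0 then Pt (fun _ => x) else Λ.mulVec x)
        - (μ : ℂ) • Pt (fun i => if (i : ℕ) = 0 then Ht (fun _ => x) else x)) :
    ∀ x : Fin n → ℂ, L (Λ.mulVec x) = Λ.mulVec (L x) := by
  intro x
  have hP := Pt.apply_ite_of_commute Λ.mulVecLin hPsymm hPres ⟨0, by omega⟩
  have hH := Ht.apply_ite_of_commute Λ.mulVecLin hHsymm hHres ⟨0, by omega⟩
  simp only [Matrix.mulVecLin_apply, Fin.ext_iff] at hP hH
  rw [hL, hL, hPres, hHres, hP, hH, Matrix.mulVec_sub, Matrix.mulVec_smul, Matrix.mulVec_smul]
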